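/- arXiv:1412.7611 — 2 statements merged into one kernel-verified Lean document; each statement's English description precedes it below -/
import Mathlib

section
/- With notation as in the setup, for A = f_a·A₀ and C = f_c·C₀ with any f_a, f_c ∈ F^×, one has: (1) σ_a(A)/A = N_{σ_c}(B); and (2) σ_c(C)/C = N_{σ_a}(B)^{−1}. -/
/-- `a` and `c` are linearly independent modulo `(F^×)^p`. -/
def LinIndepModP (p : ℕ) {F : Type*} [Field F] (a c : F) : Prop :=
  ∀ m n : ℤ, (∃ y : F, y ≠ 0 ∧ a ^ m * c ^ n = y ^ (p : ℤ)) → (p : ℤ) ∣ m ∧ (p : ℤ) ∣ n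

/-- Telescoping: `σ` multiplies `∏ σ^i(x^(n-i))` by `∏ σ^i(x) / x^(n+1)`. -/
theorem map_weighted_prod_mul_pow {F E : Type*} [Field F] [Field E] [Algebra F E]
    (σ : E ≃ₐ[F] E) (x : E) (n : ℕ) :
    σ (∏ i ∈ Finset.range n, (σ ^ i) (x ^ (n - i))) * x ^ (n + 1) =
      (∏ i ∈ Finset.range n, (σ ^ i) (x ^ (n - i))) *
        ∏ i ∈ Finset.range (n + 1), (σ ^ i) x := by
  have hlhs : σ (∏ i ∈ Finset.range n, (σ ^ i) (x ^ (n - i))) * x ^ (n + 1) =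
      ∏ i ∈ Finset.range (n + 1), (σ ^ i) (x ^ (n + 1 - i)) := by
    rw [Finset.prod_range_succ', map_prod]
    congr 1
    refine Finset.prod_congr rfl fun i _ => ?_
    rw [pow_succ' σ i, AlgEquiv.mul_apply, Nat.add_sub_add_right]
  have hrhs : ∏ i ∈ Finset.range n, (σ ^ i) (x ^ (n - i)) =
      ∏ i ∈ Finset.range (n + 1), (σ ^ i) (x ^ (n - i)) := by
    simp [Finset.prod_range_succ]
  rw [hlhs, hrhs, ← Finset.prod_mul_distrib]
  refine Finset.prod_congr rfl fun i hi => ?_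
  rw [← map_mul, ← pow_succ, Nat.succ_sub (Finset.mem_range_succ_iff.mp hi)]

/-- If `x ≠ 0` has `σ`-norm `b` over `p` steps, then `σ(A) / A = b / x^p` for
`A = f ∏ σ^i(x^(p-1-i))`. -/
theorem map_div_self_weighted_prod {F E : Type*} [Field F] [Field E] [Algebra F E]
    (σ : E ≃ₐ[F] E) {x b : E} (hx : x ≠ 0) {p : ℕ} (hp : p ≠ 0)
    (hN : ∏ i ∈ Finset.range p, (σ ^ i) x = b) {f : F} (hf : f ≠ 0) :
    σ (algebraMap F E f * ∏ i ∈ Finset.range (p - 1), (σ ^ i) (x ^ (p - 1 - i))) /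
      (algebraMap F E f * ∏ i ∈ Finset.range (p - 1), (σ ^ i) (x ^ (p - 1 - i))) =
        b / x ^ p := by
  have h := map_weighted_prod_mul_pow σ x (p - 1)
  rw [Nat.sub_add_cancel (Nat.one_le_iff_ne_zero.mpr hp), hN] at h
  have hprod : ∏ i ∈ Finset.range (p - 1), (σ ^ i) (x ^ (p - 1 - i)) ≠ 0 :=
    Finset.prod_ne_zero_iff.mpr fun i _ =>
      (map_ne_zero (σ ^ i)).mpr (pow_ne_zero _ hx)
  have hf' : algebraMap F E f ≠ 0 := by simpa using hf
  rw [map_mul, AlgEquiv.commutes, mul_div_mul_left _ _ hf',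
    div_eq_div_iff hprod (pow_ne_zero p hx), h, mul_comm]

/-- An automorphism fixing `r` acts trivially, with all its powers, on `F[r]`. -/
theorem pow_apply_eq_self_of_mem_adjoin {F E : Type*} [Field F] [Field E] [Algebra F E]
    {σ : E ≃ₐ[F] E} {r x : E} (hr : σ r = r) (hx : x ∈ Algebra.adjoin F {r}) (i : ℕ) :
    (σ ^ i) x = x := by
  have hσ : σ x = x := by
    have hle : Algebra.adjoin F {r} ≤ AlgHom.equalizer (σ : E →ₐ[F] E) (AlgHom.id F E) :=
      Algebra.adjoin_le (by simpa using hr)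
    exact hle hx
  induction i with
  | zero => rfl
  | succ i ih => rw [pow_succ, AlgEquiv.mul_apply, hσ, ih]

/-- Let `p` be a prime, `F` a field containing a primitive `p`-th root of unity `ξ`, and
`a, c ∈ F^×` linearly independent modulo `(F^×)^p`. Let `E = F(a^{1/p}, c^{1/p})`
(realized as a field `E` generated over `F` by `ra, rc` with `ra^p = a`, `rc^p = c`),
with `Gal(E/F)` generated by `σ_a, σ_c` acting as specified on `ra, rc`. Given `b ∈ F^×`,
`α ∈ F(a^{1/p})^×` with `N_{F(a^{1/p})/F}(α) = b` and `γ ∈ F(c^{1/p})^×` with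
`N_{F(c^{1/p})/F}(γ) = b`, set `A₀ = ∏_{i=0}^{p-2} σ_a^i(α^{p-1-i})`,
`C₀ = ∏_{i=0}^{p-2} σ_c^i(γ^{p-1-i})`, `B = γ/α`, and `A = f_a·A₀`, `C = f_c·C₀` for
given `f_a, f_c ∈ F^×`. Then (1) `σ_a(A)/A = N_{σ_c}(B)`, and
(2) `σ_c(C)/C = N_{σ_a}(B)⁻¹`. -/
theorem operators_AB_C (p : ℕ) [Fact p.Prime]
    (F E : Type*) [Field F] [Field E] [Algebra F E] [FiniteDimensional F E]
    (ξ : F) (hξ : IsPrimitiveRoot ξ p)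
    (a c : F) (ha : a ≠ 0) (hc : c ≠ 0) (hac : LinIndepModP p a c)
    (ra rc : E) (hra : ra ^ p = algebraMap F E a) (hrc : rc ^ p = algebraMap F E c)
    (hadj : Algebra.adjoin F {ra, rc} = ⊤)
    (σa σc : E ≃ₐ[F] E)
    (hσa_ra : σa ra = algebraMap F E ξ * ra) (hσa_rc : σa rc = rc)
    (hσc_ra : σc ra = ra) (hσc_rc : σc rc = algebraMap F E ξ * rc)
    (b : F) (hb : b ≠ 0)
    (α γ : E) (hαmem : α ∈ Algebra.adjoin F {ra}) (hγmem : γ ∈ Algebra.adjoin F {rc})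
    (hNα : ∏ i ∈ Finset.range p, (σa ^ i) α = algebraMap F E b)
    (hNγ : ∏ i ∈ Finset.range p, (σc ^ i) γ = algebraMap F E b)
    (A₀ C₀ B : E)
    (hA₀ : A₀ = ∏ i ∈ Finset.range (p - 1), (σa ^ i) (α ^ (p - 1 - i)))
    (hC₀ : C₀ = ∏ i ∈ Finset.range (p - 1), (σc ^ i) (γ ^ (p - 1 - i)))
    (hB : B = γ / α)
    (fa fc : F) (hfa : fa ≠ 0) (hfc : fc ≠ 0)
    (A C : E) (hA : A = algebraMap F E fa * A₀) (hC : C = algebraMap F E fc * C₀) :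
    σa A / A = ∏ i ∈ Finset.range p, (σc ^ i) B ∧
      σc C / C = (∏ i ∈ Finset.range p, (σa ^ i) B)⁻¹ := by
  have hp : p ≠ 0 := (Fact.out : p.Prime).ne_zero
  have hb' : algebraMap F E b ≠ 0 := by simpa using hb
  have ne_zero_of_prod (σ : E ≃ₐ[F] E) (x : E)
      (hN : ∏ i ∈ Finset.range p, (σ ^ i) x = algebraMap F E b) : x ≠ 0 := by
    rintro rfl
    exact hb' (by rw [← hN]; simp [hp])
  subst hA hC hA₀ hC₀ hB
  rw [map_div_self_weighted_prod σa (ne_zero_of_prod σa α hNα) hp hNα hfa,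
    map_div_self_weighted_prod σc (ne_zero_of_prod σc γ hNγ) hp hNγ hfc]
  simp only [map_div₀, Finset.prod_div_distrib, hNα, hNγ,
    pow_apply_eq_self_of_mem_adjoin hσc_ra hαmem, pow_apply_eq_self_of_mem_adjoin hσa_rc hγmem,
    Finset.prod_const, Finset.card_range, inv_div, and_self]
end

section
/- With notation as in the setup, there exist f_a, f_c ∈ F^× and C₁, C₂ ∈ E^× such that B = (σ_a(C₁)/C₁)·(C₂/σ_c(C₂)), N_{σ_c}(C₁) = f_a·A₀, and N_{σ_a}(C₂) = f_c·C₀; that is, the triple (f_a A₀, B, f_c C₀) is a coboundary. -/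
open Finset

/-- **Hilbert 90** for an automorphism `τ` whose first `n` powers are distinct. -/
theorem exists_eq_map_div_of_prod_pow_eq_one {F E : Type*} [Field F] [Field E] [Algebra F E]
    {n : ℕ} (hn : 0 < n) (τ : E ≃ₐ[F] E) (hτ : τ ^ n = 1)
    (hinj : ∀ i < n, ∀ j < n, τ ^ i = τ ^ j → i = j)
    {x : E} (hx : ∏ i ∈ range n, (τ ^ i) x = 1) : ∃ y : E, y ≠ 0 ∧ x = τ y / y := by
  let f : ℕ → E := fun i ↦ ∏ j ∈ range i, (τ ^ j) x
  have hf (i : ℕ) : x * τ (f i) = f (i + 1) := by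
    simp only [f, map_prod, prod_range_succ', pow_zero, AlgEquiv.one_apply, pow_succ',
      AlgEquiv.mul_apply, mul_comm]
  have hres (z : E) : x * τ (∑ i ∈ range n, f i * (τ ^ i) z) = ∑ i ∈ range n, f i * (τ ^ i) z := by
    have h (i : ℕ) : x * τ (f i * (τ ^ i) z) = f (i + 1) * (τ ^ (i + 1)) z := by
      rw [map_mul, ← mul_assoc, hf, pow_succ', AlgEquiv.mul_apply]
    have h0 : f 0 * (τ ^ 0) z = f n * (τ ^ n) z := by
      rw [hτ, pow_zero, show f n = 1 from hx, show f 0 = 1 from prod_range_zero _]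
    rw [map_sum, mul_sum, sum_congr rfl fun i _ ↦ h i]
    have h1 := sum_range_succ (fun i ↦ f i * (τ ^ i) z) n
    rw [sum_range_succ', h0] at h1
    exact add_right_cancel h1
  obtain ⟨z, hz⟩ : ∃ z : E, ∑ i ∈ range n, f i * (τ ^ i) z ≠ 0 := by
    by_contra! h
    let g : Fin n → E →* E := fun i ↦ ((τ ^ (i : ℕ) : E ≃ₐ[F] E) : E →* E)
    have hg : Function.Injective g := fun i j hij ↦ by
      refine Fin.ext (hinj i i.2 j j.2 (AlgEquiv.ext fun z ↦ ?_))
      exact DFunLike.congr_fun hij z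
    have hli := (linearIndependent_monoidHom E E).comp g hg
    have h0 := Fintype.linearIndependent_iff.mp hli (fun i ↦ f i) (by
      ext z
      simpa [g, Finset.sum_range] using h z) ⟨0, hn⟩
    simp [f] at h0
  have hτz : τ (∑ i ∈ range n, f i * (τ ^ i) z) ≠ 0 :=
    (map_ne_zero τ).mpr hz
  refine ⟨_, inv_ne_zero hz, ?_⟩
  rw [map_inv₀, div_inv_eq_mul, eq_comm, inv_mul_eq_iff_eq_mul₀ hτz, mul_comm, hres]

theorem AlgEquiv.pow_apply_eq_self {F E : Type*} [Field F] [Field E] [Algebra F E]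
    {σ : E ≃ₐ[F] E} {x : E} (h : σ x = x) (n : ℕ) : (σ ^ n) x = x := by
  induction n with
  | zero => rfl
  | succ n ih => rw [pow_succ, AlgEquiv.mul_apply, h, ih]

theorem AlgEquiv.pow_apply_of_apply_eq_mul {F E : Type*} [Field F] [Field E] [Algebra F E]
    {σ : E ≃ₐ[F] E} {ξ : F} {r : E} (h : σ r = algebraMap F E ξ * r) (n : ℕ) :
    (σ ^ n) r = algebraMap F E (ξ ^ n) * r := by
  induction n with
  | zero => simp
  | succ n ih =>
    rw [pow_succ, AlgEquiv.mul_apply, h, map_mul, AlgEquiv.commutes, ih, pow_succ, map_mul]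
    ring

theorem AlgEquiv.apply_eq_self_of_mem_adjoin {F E : Type*} [Field F] [Field E] [Algebra F E]
    {σ : E ≃ₐ[F] E} {r x : E} (h : σ r = r) (hx : x ∈ Algebra.adjoin F {r}) : σ x = x := by
  induction hx using Algebra.adjoin_induction with
  | mem y hy => rw [Set.mem_singleton_iff.mp hy, h]
  | algebraMap k => exact σ.commutes k
  | add y z _ _ hy hz => rw [map_add, hy, hz]
  | mul y z _ _ hy hz => rw [map_mul, hy, hz]

theorem AlgEquiv.ext_of_adjoin_pair_eq_top {F E : Type*} [Field F] [Field E] [Algebra F E]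
    {r s : E} (hadj : Algebra.adjoin F {r, s} = ⊤) {σ τ : E ≃ₐ[F] E} (hr : σ r = τ r)
    (hs : σ s = τ s) : σ = τ := by
  have h : (σ : E →ₐ[F] E) = τ := AlgHom.ext_of_adjoin_eq_top hadj (by
    rintro x (rfl | rfl)
    · exact hr
    · exact hs)
  exact AlgEquiv.ext fun x ↦ DFunLike.congr_fun h x

/-- The trace over the powers of `σ` of a `σ`-fixed multiple of a power of a Kummer generator. -/
theorem exists_sum_pow_apply_eq {F E : Type*} [Field F] [Field E] [Algebra F E]
    {p : ℕ} {ξ : F} (hξ : IsPrimitiveRoot ξ p) {σ : E ≃ₐ[F] E} {r : E} {a : F}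
    (hr : r ^ p = algebraMap F E a) (hσr : σ r = algebraMap F E ξ * r) (m : ℕ) :
    ∃ k : F, ∀ s : E, σ s = s → ∑ i ∈ range p, (σ ^ i) (r ^ m * s) = algebraMap F E k * s := by
  have hsum (s : E) (hs : σ s = s) : ∑ i ∈ range p, (σ ^ i) (r ^ m * s) =
      algebraMap F E (∑ i ∈ range p, (ξ ^ m) ^ i) * (r ^ m * s) := by
    rw [map_sum, sum_mul]
    refine sum_congr rfl fun i _ ↦ ?_
    rw [map_mul, map_pow, AlgEquiv.pow_apply_of_apply_eq_mul hσr, AlgEquiv.pow_apply_eq_self hs,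
      mul_pow, ← map_pow, ← pow_mul, ← pow_mul, mul_comm m i, mul_assoc]
  by_cases hm : p ∣ m
  · obtain ⟨q, rfl⟩ := hm
    refine ⟨(∑ i ∈ range p, (ξ ^ (p * q)) ^ i) * a ^ q, fun s hs ↦ ?_⟩
    rw [hsum s hs, pow_mul r, hr, map_mul, map_pow _ a, mul_assoc]
  · refine ⟨0, fun s hs ↦ ?_⟩
    have h1 : ξ ^ m ≠ 1 := fun h ↦ hm (hξ.dvd_of_pow_eq_one m h)
    have h2 : ∑ i ∈ range p, (ξ ^ m) ^ i = 0 := by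
      refine (mul_eq_zero.mp ?_).resolve_left (sub_ne_zero.mpr h1)
      rw [mul_geom_sum, ← pow_mul, mul_comm, pow_mul, hξ.pow_eq_one, one_pow, sub_self]
    rw [hsum s hs, h2, map_zero, zero_mul, zero_mul]

/-- In a Kummer extension generated by `r` and `s`, the elements fixed by the two standard
automorphisms lie in the base field. -/
theorem exists_algebraMap_eq_of_fixed {F E : Type*} [Field F] [Field E] [Algebra F E]
    {p : ℕ} (hp : p ≠ 0) {ξ : F} (hξ : IsPrimitiveRoot ξ p) {a c : F} {r s : E}
    (hr : r ^ p = algebraMap F E a) (hs : s ^ p = algebraMap F E c)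
    (hadj : Algebra.adjoin F {r, s} = ⊤) {σ τ : E ≃ₐ[F] E}
    (hσr : σ r = algebraMap F E ξ * r) (hσs : σ s = s) (hτs : τ s = algebraMap F E ξ * s)
    {x : E} (hσx : σ x = x) (hτx : τ x = x) : ∃ k : F, algebraMap F E k = x := by
  let T : E →ₗ[F] E := (∑ j ∈ range p, (τ ^ j).toLinearMap) ∘ₗ ∑ i ∈ range p, (σ ^ i).toLinearMap
  have hT (y : E) : T y = ∑ j ∈ range p, (τ ^ j) (∑ i ∈ range p, (σ ^ i) y) := by
    simp only [T, LinearMap.comp_apply, LinearMap.sum_apply, AlgEquiv.toLinearMap_apply]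
  have hmem (y : E) : T y ∈ LinearMap.range (Algebra.linearMap F E) := by
    have hy : y ∈ Submodule.span F (Submonoid.closure {r, s} : Set E) := by
      rw [← Algebra.adjoin_eq_span, hadj]
      trivial
    induction hy using Submodule.span_induction with
    | mem z hz =>
      obtain ⟨m, n, rfl⟩ := (Submonoid.mem_closure_pair _ _ _).mp hz
      obtain ⟨k, hk⟩ := exists_sum_pow_apply_eq hξ hr hσr m
      obtain ⟨l, hl⟩ := exists_sum_pow_apply_eq hξ hs hτs n
      refine ⟨l * k, ?_⟩
      rw [hT, hk _ (by rw [map_pow, hσs]), mul_comm (algebraMap F E k), hl _ (τ.commutes k),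
        Algebra.linearMap_apply, map_mul]
    | zero => rw [map_zero]; exact zero_mem _
    | add z w _ _ hz hw => rw [map_add]; exact add_mem hz hw
    | smul k z _ hz => rw [map_smul]; exact Submodule.smul_mem _ _ hz
  have hTx : T x = algebraMap F E ((p : F) * p) * x := by
    rw [hT, sum_congr rfl fun i _ ↦ AlgEquiv.pow_apply_eq_self hσx i, sum_const, card_range]
    rw [sum_congr rfl fun i _ ↦ AlgEquiv.pow_apply_eq_self
      (show τ (p • x) = p • x by rw [map_nsmul, hτx]) i, sum_const, card_range]
    simp [mul_assoc]
  obtain ⟨k, hk⟩ := hmem x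
  have : NeZero p := ⟨hp⟩
  have hp' : (p : F) ≠ 0 := (hξ.neZero').out
  refine ⟨((p : F) * p)⁻¹ * k, ?_⟩
  rw [Algebra.linearMap_apply, hTx] at hk
  rw [map_mul, hk, ← mul_assoc, ← map_mul, inv_mul_cancel₀ (mul_ne_zero hp' hp'), map_one, one_mul]

theorem AlgEquiv.map_prod_pow_apply_of_commute {F E : Type*} [Field F] [Field E] [Algebra F E]
    {σ τ : E ≃ₐ[F] E} (h : Commute τ σ) (n : ℕ) (x : E) :
    τ (∏ i ∈ range n, (σ ^ i) x) = ∏ i ∈ range n, (σ ^ i) (τ x) := by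
  rw [map_prod]
  refine prod_congr rfl fun i _ ↦ ?_
  rw [← AlgEquiv.mul_apply, (h.pow_right i).eq, AlgEquiv.mul_apply]

theorem AlgEquiv.map_prod_pow_apply_self {F E : Type*} [Field F] [Field E] [Algebra F E]
    {σ : E ≃ₐ[F] E} {n : ℕ} (h : σ ^ n = 1) {x : E} (hx : x ≠ 0) :
    σ (∏ i ∈ range n, (σ ^ i) x) = ∏ i ∈ range n, (σ ^ i) x := by
  refine mul_right_cancel₀ hx ?_
  calc σ (∏ i ∈ range n, (σ ^ i) x) * x = ∏ i ∈ range (n + 1), (σ ^ i) x := by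
        simp only [map_prod, prod_range_succ', pow_succ', AlgEquiv.mul_apply, pow_zero,
          AlgEquiv.one_apply]
    _ = _ := by rw [prod_range_succ, h, AlgEquiv.one_apply]

theorem AlgEquiv.map_prod_pow_sub_mul {F E : Type*} [Field F] [Field E] [Algebra F E]
    (σ : E ≃ₐ[F] E) {n : ℕ} (hn : n ≠ 0) (x : E) :
    σ (∏ i ∈ range (n - 1), (σ ^ i) (x ^ (n - 1 - i))) * x ^ n =
      (∏ i ∈ range n, (σ ^ i) x) * ∏ i ∈ range (n - 1), (σ ^ i) (x ^ (n - 1 - i)) := by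
  obtain ⟨n, rfl⟩ := Nat.exists_eq_succ_of_ne_zero hn
  simp only [Nat.succ_eq_add_one, Nat.add_sub_cancel]
  have h : ∏ i ∈ range n, (σ ^ i) (x ^ (n - i)) = ∏ i ∈ range (n + 1), (σ ^ i) (x ^ (n - i)) := by
    simp [prod_range_succ]
  conv_rhs => rw [h, ← prod_mul_distrib, prod_range_succ']
  rw [map_prod]
  congr 1
  · refine prod_congr rfl fun i hi ↦ ?_
    have hi' : n - i = n - (i + 1) + 1 := by have := mem_range.mp hi; omega
    rw [← AlgEquiv.mul_apply, ← pow_succ', ← map_mul, ← pow_succ', hi']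
  · simp [pow_succ']

/-- If `y` is fixed by `τ` and the `σ`-norm of `C` has the same `τ`-coboundary as `y`, then that
norm is a multiple of `y` by an element of the base field. -/
theorem exists_prod_pow_apply_eq_algebraMap_mul {F E : Type*} [Field F] [Field E] [Algebra F E]
    {n : ℕ} {σ τ : E ≃ₐ[F] E} (hσ : σ ^ n = 1)
    (hfix : ∀ x : E, σ x = x → τ x = x → ∃ k : F, algebraMap F E k = x)
    {C y : E} (hC : C ≠ 0) (hy : y ≠ 0) (hσy : σ y = y)
    (h : τ (∏ i ∈ range n, (σ ^ i) C) * y = (∏ i ∈ range n, (σ ^ i) C) * τ y) :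
    ∃ f : F, f ≠ 0 ∧ ∏ i ∈ range n, (σ ^ i) C = algebraMap F E f * y := by
  have hN : ∏ i ∈ range n, (σ ^ i) C ≠ 0 := prod_ne_zero_iff.mpr fun i _ ↦ (map_ne_zero _).mpr hC
  have hτy : τ y ≠ 0 := by simpa using hy
  obtain ⟨f, hf⟩ := hfix ((∏ i ∈ range n, (σ ^ i) C) / y)
    (by rw [map_div₀, hσy, AlgEquiv.map_prod_pow_apply_self hσ hC])
    (by rw [map_div₀, div_eq_div_iff hτy hy, h])
  refine ⟨f, ?_, by rw [hf, div_mul_cancel₀ _ hy]⟩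
  rintro rfl
  rw [map_zero] at hf
  exact div_ne_zero hN hy hf.symm

/-- Let `p` be a prime, `F` a field containing a primitive `p`-th root of unity `ξ`, and
`a, c ∈ F^×` linearly independent modulo `(F^×)^p`. Let `E = F(a^{1/p}, c^{1/p})` with
`Gal(E/F)` generated by `σ_a, σ_c` as specified. Given `b ∈ F^×`, `α ∈ F(a^{1/p})^×`
with `N_{F(a^{1/p})/F}(α) = b` and `γ ∈ F(c^{1/p})^×` with `N_{F(c^{1/p})/F}(γ) = b`,
set `A₀ = ∏_{i=0}^{p-2} σ_a^i(α^{p-1-i})`, `C₀ = ∏_{i=0}^{p-2} σ_c^i(γ^{p-1-i})`, and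
`B = γ/α`. Then there exist `f_a, f_c ∈ F^×` and `C₁, C₂ ∈ E^×` with
`B = (σ_a(C₁)/C₁)·(C₂/σ_c(C₂))`, `N_{σ_c}(C₁) = f_a·A₀` and `N_{σ_a}(C₂) = f_c·C₀`;
that is, the triple `(f_a·A₀, B, f_c·C₀)` is a coboundary. -/
theorem triple_is_coboundary (p : ℕ) [Fact p.Prime]
    (F E : Type*) [Field F] [Field E] [Algebra F E] [FiniteDimensional F E]
    (ξ : F) (hξ : IsPrimitiveRoot ξ p)
    (a c : F) (ha : a ≠ 0) (hc : c ≠ 0) (hac : LinIndepModP p a c)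
    (ra rc : E) (hra : ra ^ p = algebraMap F E a) (hrc : rc ^ p = algebraMap F E c)
    (hadj : Algebra.adjoin F {ra, rc} = ⊤)
    (σa σc : E ≃ₐ[F] E)
    (hσa_ra : σa ra = algebraMap F E ξ * ra) (hσa_rc : σa rc = rc)
    (hσc_ra : σc ra = ra) (hσc_rc : σc rc = algebraMap F E ξ * rc)
    (b : F) (hb : b ≠ 0)
    (α γ : E) (hαmem : α ∈ Algebra.adjoin F {ra}) (hγmem : γ ∈ Algebra.adjoin F {rc})
    (hNα : ∏ i ∈ Finset.range p, (σa ^ i) α = algebraMap F E b)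
    (hNγ : ∏ i ∈ Finset.range p, (σc ^ i) γ = algebraMap F E b)
    (A₀ C₀ B : E)
    (hA₀ : A₀ = ∏ i ∈ Finset.range (p - 1), (σa ^ i) (α ^ (p - 1 - i)))
    (hC₀ : C₀ = ∏ i ∈ Finset.range (p - 1), (σc ^ i) (γ ^ (p - 1 - i)))
    (hB : B = γ / α) :
    ∃ fa fc : F, fa ≠ 0 ∧ fc ≠ 0 ∧
      ∃ C₁ C₂ : E, C₁ ≠ 0 ∧ C₂ ≠ 0 ∧
        B = (σa C₁ / C₁) * (C₂ / σc C₂) ∧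
        (∏ i ∈ Finset.range p, (σc ^ i) C₁ = algebraMap F E fa * A₀) ∧
        (∏ i ∈ Finset.range p, (σa ^ i) C₂ = algebraMap F E fc * C₀) := by
  have hp : p ≠ 0 := (Fact.out : p.Prime).ne_zero
  have hpow {σ : E ≃ₐ[F] E} {r : E} (h : σ r = algebraMap F E ξ * r) : (σ ^ p) r = r := by
    rw [AlgEquiv.pow_apply_of_apply_eq_mul h, hξ.pow_eq_one, map_one, one_mul]
  have hσa : σa ^ p = 1 := AlgEquiv.ext_of_adjoin_pair_eq_top hadj (hpow hσa_ra)
    (AlgEquiv.pow_apply_eq_self hσa_rc p)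
  have hσc : σc ^ p = 1 := AlgEquiv.ext_of_adjoin_pair_eq_top hadj
    (AlgEquiv.pow_apply_eq_self hσc_ra p) (hpow hσc_rc)
  have hcomm : Commute σa σc := AlgEquiv.ext_of_adjoin_pair_eq_top hadj
    (by simp [hσa_ra, hσc_ra]) (by simp [hσa_rc, hσc_rc])
  have hfix (x : E) (h₁ : σa x = x) (h₂ : σc x = x) : ∃ k : F, algebraMap F E k = x :=
    exists_algebraMap_eq_of_fixed hp hξ hra hrc hadj hσa_ra hσa_rc hσc_rc h₁ h₂
  have hσcα : σc α = α := AlgEquiv.apply_eq_self_of_mem_adjoin hσc_ra hαmem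
  have hσaγ : σa γ = γ := AlgEquiv.apply_eq_self_of_mem_adjoin hσa_rc hγmem
  have hb' : algebraMap F E b ≠ 0 := by simpa using hb
  have hne {σ : E ≃ₐ[F] E} {x : E} (h : ∏ i ∈ range p, (σ ^ i) x = algebraMap F E b) :
      x ≠ 0 := by
    rintro rfl
    rw [← h] at hb'
    exact prod_ne_zero_iff.mp hb' 0 (mem_range.mpr hp.bot_lt) (map_zero _)
  have hα : α ≠ 0 := hne hNα
  have hγ : γ ≠ 0 := hne hNγ
  have hA₀ne : A₀ ≠ 0 := by
    rw [hA₀]; exact prod_ne_zero_iff.mpr fun i _ ↦ (map_ne_zero _).mpr (pow_ne_zero _ hα)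
  have hC₀ne : C₀ ≠ 0 := by
    rw [hC₀]; exact prod_ne_zero_iff.mpr fun i _ ↦ (map_ne_zero _).mpr (pow_ne_zero _ hγ)
  have hσcA₀ : σc A₀ = A₀ := by
    rw [hA₀, map_prod]
    refine prod_congr rfl fun i _ ↦ ?_
    rw [← AlgEquiv.mul_apply, (hcomm.symm.pow_right i).eq, AlgEquiv.mul_apply, map_pow σc, hσcα]
  have hσaC₀ : σa C₀ = C₀ := by
    rw [hC₀, map_prod]
    refine prod_congr rfl fun i _ ↦ ?_
    rw [← AlgEquiv.mul_apply, (hcomm.pow_right i).eq, AlgEquiv.mul_apply, map_pow σa, hσaγ]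
  have hσaA₀ : σa A₀ * α ^ p = algebraMap F E b * A₀ := by
    rw [hA₀, AlgEquiv.map_prod_pow_sub_mul σa hp, hNα]
  have hσcC₀ : σc C₀ * γ ^ p = algebraMap F E b * C₀ := by
    rw [hC₀, AlgEquiv.map_prod_pow_sub_mul σc hp, hNγ]
  have hNcB : ∏ i ∈ range p, (σc ^ i) B = algebraMap F E b / α ^ p := by
    simp only [hB, map_div₀, prod_div_distrib, AlgEquiv.pow_apply_eq_self hσcα, hNγ, prod_const,
      card_range]
  have hNaB : ∏ i ∈ range p, (σa ^ i) B = γ ^ p / algebraMap F E b := by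
    simp only [hB, map_div₀, prod_div_distrib, AlgEquiv.pow_apply_eq_self hσaγ, hNα, prod_const,
      card_range]
  have hra0 : ra ≠ 0 := by
    rintro rfl
    rw [zero_pow hp, eq_comm, map_eq_zero] at hra
    exact ha hra
  obtain ⟨C, hC, hBC⟩ : ∃ C : E, C ≠ 0 ∧ B = (σa * σc) C / C := by
    refine exists_eq_map_div_of_prod_pow_eq_one hp.bot_lt (σa * σc) ?_ (fun i hi j hj hij ↦ ?_) ?_
    · rw [hcomm.mul_pow, hσa, hσc, one_mul]
    · have h := DFunLike.congr_fun hij ra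
      have hτ : (σa * σc) ra = algebraMap F E ξ * ra := by
        rw [AlgEquiv.mul_apply, hσc_ra, hσa_ra]
      rw [AlgEquiv.pow_apply_of_apply_eq_mul hτ, AlgEquiv.pow_apply_of_apply_eq_mul hτ] at h
      exact hξ.pow_inj hi hj ((algebraMap F E).injective (mul_right_cancel₀ hra0 h))
    · have hτα (i : ℕ) : ((σa * σc) ^ i) α = (σa ^ i) α := by
        rw [hcomm.mul_pow, AlgEquiv.mul_apply, AlgEquiv.pow_apply_eq_self hσcα]
      have hτγ (i : ℕ) : ((σa * σc) ^ i) γ = (σc ^ i) γ := by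
        rw [hcomm.eq, hcomm.symm.mul_pow, AlgEquiv.mul_apply, AlgEquiv.pow_apply_eq_self hσaγ]
      simp only [hB, map_div₀, prod_div_distrib, hτα, hτγ, hNα, hNγ, div_self hb']
  rw [AlgEquiv.mul_apply] at hBC
  have hσcC : σc C ≠ 0 := by simpa using hC
  have hB₁ : B * σc C * σc C⁻¹ = σa (σc C) * C⁻¹ := by
    rw [hBC, map_inv₀]; field_simp
  have hNσ {σ : E ≃ₐ[F] E} (h : σ ^ p = 1) {x : E} (hx : x ≠ 0) :
      ∏ i ∈ range p, (σ ^ i) (σ x) = ∏ i ∈ range p, (σ ^ i) x := by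
    rw [← AlgEquiv.map_prod_pow_apply_of_commute (Commute.refl σ),
      AlgEquiv.map_prod_pow_apply_self h hx]
  have hN0 (σ : E ≃ₐ[F] E) {x : E} (hx : x ≠ 0) : ∏ i ∈ range p, (σ ^ i) x ≠ 0 :=
    prod_ne_zero_iff.mpr fun i _ ↦ (map_ne_zero _).mpr hx
  have hC' : C⁻¹ ≠ 0 := inv_ne_zero hC
  obtain ⟨fa, hfa, hNa⟩ := exists_prod_pow_apply_eq_algebraMap_mul (τ := σa) hσc
    (fun x h₁ h₂ ↦ hfix x h₂ h₁) hσcC hA₀ne hσcA₀ (by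
      have h : (∏ i ∈ range p, (σc ^ i) B) * (∏ i ∈ range p, (σc ^ i) (σc C)) =
          ∏ i ∈ range p, (σc ^ i) (σa (σc C)) := by
        refine mul_right_cancel₀ (hN0 σc hC') ?_
        conv_lhs => rw [← hNσ hσc hC']
        simp only [← prod_mul_distrib, ← map_mul, hB₁]
      rw [AlgEquiv.map_prod_pow_apply_of_commute hcomm, ← h, hNcB]
      field_simp
      linear_combination -(∏ i ∈ range p, (σc ^ i) (σc C)) * hσaA₀)
  obtain ⟨fc, hfc, hNc⟩ := exists_prod_pow_apply_eq_algebraMap_mul (τ := σc) hσa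
    hfix hC' hC₀ne hσaC₀ (by
      have h : (∏ i ∈ range p, (σa ^ i) B) * (∏ i ∈ range p, (σa ^ i) (σc C⁻¹)) =
          ∏ i ∈ range p, (σa ^ i) C⁻¹ := by
        refine mul_right_cancel₀ (hN0 σa hσcC) ?_
        conv_rhs => rw [← hNσ hσa hσcC]
        simp only [← prod_mul_distrib, ← map_mul, mul_right_comm B, hB₁, mul_comm (C⁻¹)]
      rw [AlgEquiv.map_prod_pow_apply_of_commute hcomm.symm, ← h, hNaB]
      generalize ∏ i ∈ range p, (σa ^ i) (σc C⁻¹) = N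
      field_simp
      linear_combination -N * hσcC₀)
  refine ⟨fa, fc, hfa, hfc, σc C, C⁻¹, hσcC, hC', ?_, hNa, hNc⟩
  rw [hBC, map_inv₀]
  field_simp
end
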